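/- Let G be a simple graph on n vertices and let A ∈ S(G) have exactly q distinct eigenvalues. Then A has the strong multiplicity property (SMP) if and only if S^cl(G) + {KᵀA + AK : K an n×n real skew-symmetric matrix} + span{A^k : k = 0,…,q−1} = Sym_n(ℝ). -/

import Mathlib

open Matrix Polynomial

/-- `A` belongs to `S(G)`: symmetric, with off-diagonal nonzero pattern given by `G`. -/
def sMem {n : ℕ} (G : SimpleGraph (Fin n)) (A : Matrix (Fin n) (Fin n) ℝ) : Prop :=
  A.IsSymm ∧ ∀ i j, i ≠ j → (A i j ≠ 0 ↔ G.Adj i j)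

/-- `B` belongs to `S^cl(G)`: symmetric, with off-diagonal zeros on non-edges. -/
def sclMem {n : ℕ} (G : SimpleGraph (Fin n)) (B : Matrix (Fin n) (Fin n) ℝ) : Prop :=
  B.IsSymm ∧ ∀ i j, i ≠ j → ¬ G.Adj i j → B i j = 0

/-- The number of distinct (real) eigenvalues of `A`. -/
noncomputable def qDist {n : ℕ} (A : Matrix (Fin n) (Fin n) ℝ) : ℕ :=
  A.charpoly.roots.toFinset.card

/-- The strong multiplicity property. -/
def HasSMP {n : ℕ} (A : Matrix (Fin n) (Fin n) ℝ) : Prop :=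
  ∀ X : Matrix (Fin n) (Fin n) ℝ, X.IsSymm →
    (∀ i j, A i j * X i j = 0) → (∀ i, X i i = 0) → A * X = X * A →
    (∀ k < qDist A, Matrix.trace (A ^ k * X) = 0) → X = 0

namespace Matrix

variable {n : ℕ}

/-- The subspace `S^cl(G) + {KᵀA + AK : K skew} + span{A^k : k = 0,…,q-1}`. -/
def smpSubmodule (G : SimpleGraph (Fin n)) (A : Matrix (Fin n) (Fin n) ℝ) (q : ℕ) :
    Submodule ℝ (Matrix (Fin n) (Fin n) ℝ) where
  carrier := {M | ∃ (B K : Matrix (Fin n) (Fin n) ℝ) (c : Fin q → ℝ),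
    sclMem G B ∧ Kᵀ = -K ∧ M = B + Kᵀ * A + A * K + ∑ k : Fin q, c k • A ^ (k : ℕ)}
  zero_mem' := ⟨0, 0, 0, ⟨by simp [IsSymm], by simp⟩, by simp, by simp⟩
  add_mem' := by
    rintro _ _ ⟨B, K, c, hB, hK, rfl⟩ ⟨B', K', c', hB', hK', rfl⟩
    refine ⟨B + B', K + K', c + c', ⟨hB.1.add hB'.1, fun i j hij hG => ?_⟩, ?_, ?_⟩
    · simp [hB.2 i j hij hG, hB'.2 i j hij hG]
    · rw [transpose_add, hK, hK', neg_add]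
    · simp only [transpose_add, add_mul, mul_add, Pi.add_apply, add_smul,
        Finset.sum_add_distrib]
      abel
  smul_mem' := by
    rintro r _ ⟨B, K, c, hB, hK, rfl⟩
    refine ⟨r • B, r • K, r • c, ⟨hB.1.smul r, fun i j hij hG => ?_⟩, ?_, ?_⟩
    · simp [hB.2 i j hij hG]
    · rw [transpose_smul, hK, smul_neg]
    · simp [smul_add, Finset.smul_sum, smul_smul]

theorem isSymm_of_mem_smpSubmodule {G : SimpleGraph (Fin n)} {A M : Matrix (Fin n) (Fin n) ℝ}
    {q : ℕ} (hA : A.IsSymm) (hM : M ∈ smpSubmodule G A q) : M.IsSymm := by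
  obtain ⟨B, K, c, hB, hK, rfl⟩ := hM
  simp only [IsSymm, transpose_add, transpose_mul, transpose_sum, transpose_smul, transpose_pow,
    transpose_transpose, hA.eq, hB.1.eq]
  abel

theorem mem_smpSubmodule_of_sclMem {G : SimpleGraph (Fin n)} {A B : Matrix (Fin n) (Fin n) ℝ}
    {q : ℕ} (hB : sclMem G B) : B ∈ smpSubmodule G A q :=
  ⟨B, 0, 0, hB, by simp, by simp⟩

theorem commutator_mem_smpSubmodule {G : SimpleGraph (Fin n)} {A K : Matrix (Fin n) (Fin n) ℝ}
    {q : ℕ} (hK : Kᵀ = -K) : A * K - K * A ∈ smpSubmodule G A q :=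
  ⟨0, K, 0, ⟨by simp [IsSymm], by simp⟩, hK, by simp [hK]; abel⟩

theorem pow_mem_smpSubmodule {G : SimpleGraph (Fin n)} {A : Matrix (Fin n) (Fin n) ℝ}
    {q k : ℕ} (hk : k < q) : A ^ k ∈ smpSubmodule G A q :=
  ⟨0, 0, Pi.single ⟨k, hk⟩ 1, ⟨by simp [IsSymm], by simp⟩, by simp, by
    simp [Pi.single_apply, ite_smul]⟩

theorem eq_zero_of_trace_transpose_mul_self {X : Matrix (Fin n) (Fin n) ℝ}
    (h : trace (Xᵀ * X) = 0) : X = 0 := by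
  rwa [← conjTranspose_eq_transpose_of_trivial, trace_conjTranspose_mul_self_eq_zero_iff] at h

/-- A functional on matrices is represented on symmetric matrices by a symmetric matrix. -/
theorem exists_isSymm_trace_mul_eq (f : Module.Dual ℝ (Matrix (Fin n) (Fin n) ℝ)) :
    ∃ X : Matrix (Fin n) (Fin n) ℝ, X.IsSymm ∧ ∀ Y, Y.IsSymm → trace (X * Y) = 2 * f Y := by
  let F : Matrix (Fin n) (Fin n) ℝ := of fun i j => f (single j i 1)
  have hF (Y) : trace (F * Y) = f Y := by
    conv_rhs => rw [matrix_eq_sum_single Y]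
    have h (i j) : f (single i j (Y i j)) = Y i j * f (single i j 1) := by
      rw [← smul_eq_mul, ← map_smul, smul_single, smul_eq_mul, mul_one]
    simp only [map_sum, h]
    rw [Finset.sum_comm]
    simp [trace, mul_apply, F, mul_comm]
  refine ⟨F + Fᵀ, ?_, fun Y hY => ?_⟩
  · simp [IsSymm, add_comm]
  · have h : trace (Fᵀ * Y) = trace (F * Y) := by
      rw [← trace_transpose, transpose_mul, transpose_transpose, hY.eq, trace_mul_comm]
    rw [add_mul, trace_add, h, hF, two_mul]

theorem trace_mul_eq_zero_of_sclMem {G : SimpleGraph (Fin n)} {A X B : Matrix (Fin n) (Fin n) ℝ}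
    (hA : sMem G A) (hAX : ∀ i j, A i j * X i j = 0) (hX : ∀ i, X i i = 0)
    (hB : sclMem G B) : trace (X * B) = 0 := by
  simp only [trace, diag_apply, mul_apply]
  refine Finset.sum_eq_zero fun i _ => Finset.sum_eq_zero fun j _ => ?_
  by_cases hij : i = j
  · simp [hij, hX]
  by_cases hG : G.Adj i j
  · simp [(mul_eq_zero.mp (hAX i j)).resolve_left ((hA.2 i j hij).mpr hG)]
  · simp [hB.2 j i (Ne.symm hij) (fun h => hG h.symm)]

theorem trace_mul_commutator (X A K : Matrix (Fin n) (Fin n) ℝ) :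
    trace (X * (A * K - K * A)) = trace ((X * A - A * X) * K) := by
  rw [mul_sub, sub_mul, trace_sub, trace_sub, ← mul_assoc, ← mul_assoc X K A,
    trace_mul_comm (X * K) A, ← mul_assoc]

theorem trace_mul_eq_zero_of_mem_smpSubmodule {G : SimpleGraph (Fin n)}
    {A X M : Matrix (Fin n) (Fin n) ℝ} {q : ℕ} (hA : sMem G A)
    (hAX : ∀ i j, A i j * X i j = 0) (hX : ∀ i, X i i = 0) (hcomm : A * X = X * A)
    (htr : ∀ k < q, trace (A ^ k * X) = 0) (hM : M ∈ smpSubmodule G A q) :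
    trace (X * M) = 0 := by
  obtain ⟨B, K, c, hB, hK, rfl⟩ := hM
  have hsplit : B + Kᵀ * A + A * K + ∑ k : Fin q, c k • A ^ (k : ℕ) =
      B + (A * K - K * A) + ∑ k : Fin q, c k • A ^ (k : ℕ) := by
    rw [hK, neg_mul]; abel
  rw [hsplit, mul_add, mul_add, trace_add, trace_add,
    trace_mul_eq_zero_of_sclMem hA hAX hX hB, trace_mul_commutator, hcomm, sub_self, zero_mul,
    trace_zero, zero_add, zero_add, Finset.mul_sum, trace_sum]
  refine Finset.sum_eq_zero fun k _ => ?_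
  rw [Matrix.mul_smul, trace_smul, trace_mul_comm, htr k k.2, smul_zero]

theorem sclMem_single_add_single {G : SimpleGraph (Fin n)} {i j : Fin n}
    (h : i = j ∨ G.Adj i j) : sclMem G (single i j 1 + single j i 1) := by
  refine ⟨by simp [IsSymm, add_comm], fun a b hab hG => ?_⟩
  have h₁ : ¬ (i = a ∧ j = b) := by
    rintro ⟨rfl, rfl⟩
    exact h.elim hab hG
  have h₂ : ¬ (j = a ∧ i = b) := by
    rintro ⟨rfl, rfl⟩
    exact h.elim (fun h => hab h.symm) (fun h => hG h.symm)
  simp [h₁, h₂]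

theorem apply_eq_zero_of_trace_mul_eq_zero {G : SimpleGraph (Fin n)}
    {X : Matrix (Fin n) (Fin n) ℝ} (hX : X.IsSymm)
    (h : ∀ B, sclMem G B → trace (X * B) = 0) {i j : Fin n} (hij : i = j ∨ G.Adj i j) :
    X i j = 0 := by
  have := h _ (sclMem_single_add_single hij)
  rw [mul_add, trace_add, trace_mul_single, trace_mul_single, hX.apply] at this
  simpa using this

/-- If `X` is symmetric and trace-orthogonal to all `AK - KA` with `K` skew, then `X` commutes
with `A`. -/
theorem mul_comm_of_trace_mul_commutator_eq_zero {A X : Matrix (Fin n) (Fin n) ℝ}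
    (hA : A.IsSymm) (hX : X.IsSymm)
    (h : ∀ K : Matrix (Fin n) (Fin n) ℝ, Kᵀ = -K → trace (X * (A * K - K * A)) = 0) :
    A * X = X * A := by
  have hD : (X * A - A * X)ᵀ = -(X * A - A * X) := by
    simp [transpose_mul, hA.eq, hX.eq]
  have h0 := h _ hD
  rw [trace_mul_commutator] at h0
  refine (sub_eq_zero.mp (eq_zero_of_trace_transpose_mul_self ?_)).symm
  rw [hD, neg_mul, trace_neg, h0, neg_zero]

end Matrix

/-- Proposition 1(b): `A ∈ S(G)` with exactly `q` distinct eigenvalues has the SMP iff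
`S^cl(G) + {KᵀA + AK : K skew} + span{A^k : k = 0,…,q-1} = Sym_n(ℝ)`. -/
theorem smp_iff_sum_eq_sym (n q : ℕ) (G : SimpleGraph (Fin n))
    (A : Matrix (Fin n) (Fin n) ℝ) (hA : sMem G A) (hq : qDist A = q) :
    HasSMP A ↔
      ∀ M : Matrix (Fin n) (Fin n) ℝ, M.IsSymm →
        ∃ (B K : Matrix (Fin n) (Fin n) ℝ) (c : Fin q → ℝ),
          sclMem G B ∧ Kᵀ = -K ∧
          M = B + Kᵀ * A + A * K + ∑ k : Fin q, c k • A ^ (k : ℕ) := by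
  subst hq
  change HasSMP A ↔ ∀ M : Matrix (Fin n) (Fin n) ℝ, M.IsSymm → M ∈ smpSubmodule G A (qDist A)
  constructor
  · intro h M hM
    by_contra hMW
    obtain ⟨f, hfM, hfW⟩ := Submodule.exists_le_ker_of_notMem hMW
    obtain ⟨X, hX, hXf⟩ := exists_isSymm_trace_mul_eq f
    have horth : ∀ Y ∈ smpSubmodule G A (qDist A), trace (X * Y) = 0 := fun Y hY => by
      rw [hXf Y (isSymm_of_mem_smpSubmodule hA.1 hY), LinearMap.mem_ker.mp (hfW hY), mul_zero]
    have hentry {i j : Fin n} : i = j ∨ G.Adj i j → X i j = 0 :=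
      apply_eq_zero_of_trace_mul_eq_zero hX fun B hB => horth B (mem_smpSubmodule_of_sclMem hB)
    have hX0 : X = 0 := by
      refine h X hX (fun i j => ?_) (fun i => hentry (Or.inl rfl)) ?_ fun k hk => ?_
      · by_cases hij : i = j ∨ G.Adj i j
        · rw [hentry hij, mul_zero]
        · obtain ⟨hne, hG⟩ := not_or.mp hij
          rw [not_not.mp (mt (hA.2 i j hne).mp hG), zero_mul]
      · exact mul_comm_of_trace_mul_commutator_eq_zero hA.1 hX fun K hK =>
          horth _ (commutator_mem_smpSubmodule hK)
      · rw [trace_mul_comm]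
        exact horth _ (pow_mem_smpSubmodule hk)
    have := hXf M hM
    simp only [hX0, zero_mul, trace_zero] at this
    exact hfM (by linarith)
  · intro h X hX hAX hdiag hcomm htr
    apply eq_zero_of_trace_transpose_mul_self
    rw [hX.eq]
    exact trace_mul_eq_zero_of_mem_smpSubmodule hA hAX hdiag hcomm htr (h X hX)
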